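/- arXiv:1506.01799 — 7 statements merged into one kernel-verified Lean document; each statement's English description precedes it below -/
import Mathlib

section
/- Let G' contain a vertex of eccentricity at most 2 if and only if there exists a ∈ A with a ∩ b ≠ ∅ for every b ∈ B. More precisely: if some a ∈ A satisfies a ∩ b ≠ ∅ for every b ∈ B, then the vertex a has distance at most 2 to every vertex of G'; and if no member of A intersects every member of B, then every vertex of G' has eccentricity at least 3. -/
/-- Vertex set of the graph `G'`: the disjoint union of the index sets of the
families `A` and `B`, the universe `U`, and three extra vertices `x`, `y`, `z`. -/
inductive V0 (ιA ιB U : Type) where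
  | a : ιA → V0 ιA ιB U
  | b : ιB → V0 ιA ιB U
  | u : U → V0 ιA ιB U
  | x : V0 ιA ιB U
  | y : V0 ιA ιB U
  | z : V0 ιA ιB U

/-- The edge relation of `G'` (one direction of each undirected edge):
`{a,u}` for `u ∈ A i`; `{u,b}` for `u ∈ B j`; `{a,x}`, `{a,y}` for all `a ∈ A`;
`{u,x}` for all `u ∈ U`; and `{y,z}`. -/
def R0 {ιA ιB U : Type} (A : ιA → Set U) (B : ιB → Set U) :
    V0 ιA ιB U → V0 ιA ιB U → Prop
  | .a i, .u w => w ∈ A i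
  | .u w, .b j => w ∈ B j
  | .a _, .x => True
  | .a _, .y => True
  | .u _, .x => True
  | .y, .z => True
  | _, _ => False

theorem SimpleGraph.three_le_edist {V : Type*} {G : SimpleGraph V} {v w : V} (hne : v ≠ w)
    (hadj : ¬ G.Adj v w) (hcommon : ∀ t, G.Adj v t → ¬ G.Adj t w) : 3 ≤ G.edist v w := by
  refine le_iInf fun p => ?_
  rcases p with _ | ⟨h, _ | ⟨h', _ | ⟨h'', q⟩⟩⟩
  · exact absurd rfl hne
  · exact absurd h hadj
  · exact absurd h' (hcommon _ h)
  · simp only [SimpleGraph.Walk.length_cons]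
    exact_mod_cast Nat.le_add_left 3 q.length

theorem SimpleGraph.edist_le_two_of_adj_of_adj {V : Type*} {G : SimpleGraph V} {v t w : V}
    (h : G.Adj v t) (h' : G.Adj t w) : G.edist v w ≤ 2 :=
  (SimpleGraph.Walk.cons h (SimpleGraph.Walk.cons h' SimpleGraph.Walk.nil)).edist_le

theorem SimpleGraph.edist_le_two_of_adj {V : Type*} {G : SimpleGraph V} {v w : V}
    (h : G.Adj v w) : G.edist v w ≤ 2 :=
  (SimpleGraph.Walk.cons h SimpleGraph.Walk.nil).edist_le.trans (by simp)

/-- If some `a ∈ A` intersects every member of `B`, then the vertex `a` has distance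
at most `2` to every vertex of `G'`; and if no member of `A` intersects every member
of `B`, then every vertex of `G'` has eccentricity at least `3`. -/
theorem stmt_0 {ιA ιB U : Type} [Fintype ιA] [Fintype ιB] [Fintype U]
    (A : ιA → Set U) (B : ιB → Set U) :
    (∀ i : ιA, (∀ j : ιB, (A i ∩ B j).Nonempty) →
        ∀ w : V0 ιA ιB U, (SimpleGraph.fromRel (R0 A B)).edist (V0.a i) w ≤ 2) ∧
    ((¬ ∃ i : ιA, ∀ j : ιB, (A i ∩ B j).Nonempty) →
        ∀ v : V0 ιA ιB U,
          3 ≤ ⨆ w : V0 ιA ιB U, (SimpleGraph.fromRel (R0 A B)).edist v w) := by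
  refine ⟨fun i hi w => ?_, fun hA v => ?_⟩
  · have hx : (SimpleGraph.fromRel (R0 A B)).Adj (V0.a i) V0.x := by simp [R0]
    have hy : (SimpleGraph.fromRel (R0 A B)).Adj (V0.a i) V0.y := by simp [R0]
    cases w with
    | a k => exact SimpleGraph.edist_le_two_of_adj_of_adj hx (by simp [R0])
    | b j =>
      obtain ⟨t, htA, htB⟩ := hi j
      exact SimpleGraph.edist_le_two_of_adj_of_adj (t := V0.u t) (by simp [R0, htA])
        (by simp [R0, htB])
    | u t => exact SimpleGraph.edist_le_two_of_adj_of_adj hx (by simp [R0])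
    | x => exact SimpleGraph.edist_le_two_of_adj hx
    | y => exact SimpleGraph.edist_le_two_of_adj hy
    | z => exact SimpleGraph.edist_le_two_of_adj_of_adj hy (by simp [R0])
  · suffices h : ∃ w, 3 ≤ (SimpleGraph.fromRel (R0 A B)).edist v w from
      h.elim fun w hw => hw.trans (le_iSup _ w)
    push Not at hA
    cases v with
    | a i =>
      obtain ⟨j, hj⟩ := hA i
      refine ⟨V0.b j, SimpleGraph.three_le_edist (by simp) (by simp [R0]) ?_⟩
      rintro (_ | _ | t | _ | _ | _) <;> simp [R0]
      exact fun htA htB => (Set.ext_iff.mp hj t).mp ⟨htA, htB⟩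
    | b j =>
      refine ⟨V0.y, SimpleGraph.three_le_edist (by simp) (by simp [R0]) ?_⟩
      rintro (_ | _ | _ | _ | _ | _) <;> simp [R0]
    | u t =>
      refine ⟨V0.z, SimpleGraph.three_le_edist (by simp) (by simp [R0]) ?_⟩
      rintro (_ | _ | _ | _ | _ | _) <;> simp [R0]
    | x =>
      refine ⟨V0.z, SimpleGraph.three_le_edist (by simp) (by simp [R0]) ?_⟩
      rintro (_ | _ | _ | _ | _ | _) <;> simp [R0]
    | y =>
      rcases isEmpty_or_nonempty ιB with hB | ⟨⟨j⟩⟩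
      · refine ⟨V0.x, SimpleGraph.three_le_edist (by simp) (by simp [R0]) ?_⟩
        rintro (i | _ | _ | _ | _ | _) <;> simp [R0]
        exact hB.elim (hA i).choose
      · refine ⟨V0.b j, SimpleGraph.three_le_edist (by simp) (by simp [R0]) ?_⟩
        rintro (_ | _ | _ | _ | _ | _) <;> simp [R0]
    | z =>
      refine ⟨V0.x, SimpleGraph.three_le_edist (by simp) (by simp [R0]) ?_⟩
      rintro (_ | _ | _ | _ | _ | _) <;> simp [R0]
end

section
/- For every a ∈ A: (i) if for every b ∈ B there is a coordinate j with a(j)=b(j)=1, then the eccentricity of the vertex a in G is at most 3; (ii) if some b ∈ B is orthogonal to a, then the distance in G from a to the copy b' ∈ B' is at least 5, and hence the eccentricity of a is at least 5. -/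
/-- Vertex set of the graph `G`: the disjoint union of the index sets of the
vector families `A` and `B`, a second copy `B'` of `B`, the coordinate set
`C = Fin d`, and two extra vertices `x`, `y`. -/
inductive V1 (ιA ιB : Type) (d : ℕ) where
  | a : ιA → V1 ιA ιB d
  | b : ιB → V1 ιA ιB d
  | b' : ιB → V1 ιA ιB d
  | c : Fin d → V1 ιA ιB d
  | x : V1 ιA ιB d
  | y : V1 ιA ιB d

/-- The edge relation of `G` (one direction of each undirected edge):
`{v,j}` whenever `v ∈ A ∪ B` has a `1` in coordinate `j`; `{b,b'}` for each `b ∈ B`;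
`{x,a}` for every `a ∈ A`; `{y,j}` for every coordinate `j`; and `{x,y}`. -/
def R1 {ιA ιB : Type} {d : ℕ} (A : ιA → Fin d → Bool) (B : ιB → Fin d → Bool) :
    V1 ιA ιB d → V1 ιA ιB d → Prop
  | .a i, .c j => A i j = true
  | .b i, .c j => B i j = true
  | .b i, .b' i' => i = i'
  | .x, .a _ => True
  | .y, .c _ => True
  | .x, .y => True
  | _, _ => False

/-- A function that drops by at most one along each edge drops by at most the distance. -/
theorem SimpleGraph.le_add_edist_of_adj {V : Type*} {G : SimpleGraph V} {f : V → ℕ}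
    (hf : ∀ u v, G.Adj u v → f u ≤ f v + 1) (u v : V) :
    (f u : ℕ∞) ≤ f v + G.edist u v := by
  by_cases h : G.edist u v = ⊤
  · simp [h]
  · obtain ⟨p, hp⟩ := G.exists_walk_of_edist_ne_top h
    rw [← hp]
    clear h hp
    have key : f u ≤ f v + p.length := by
      induction p with
      | nil => simp
      | cons hadj p ih =>
        have := hf _ _ hadj
        rw [SimpleGraph.Walk.length_cons]
        omega
    exact_mod_cast key

open Classical in
/-- A lower bound for the distance to the copy of `j : ιB`. -/
noncomputable def distLowerBound {ιA ιB : Type} {d : ℕ} (A : ιA → Fin d → Bool)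
    (B : ιB → Fin d → Bool) (j : ιB) : V1 ιA ιB d → ℕ
  | .a i => if ∃ k, A i k = true ∧ B j k = true then 3 else 5
  | .b j' => if j' = j then 1 else 3
  | .b' j' => if j' = j then 0 else 4
  | .c k => if B j k = true then 2 else 4
  | .x => 4
  | .y => 3

theorem distLowerBound_le_of_rel {ιA ιB : Type} {d : ℕ} {A : ιA → Fin d → Bool}
    {B : ιB → Fin d → Bool} (j : ιB) {u v : V1 ιA ιB d} (h : R1 A B u v) :
    distLowerBound A B j u ≤ distLowerBound A B j v + 1 ∧
      distLowerBound A B j v ≤ distLowerBound A B j u + 1 := by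
  cases u <;> cases v <;> simp only [R1] at h <;> simp only [distLowerBound] <;>
    (try split_ifs) <;> grind

theorem fromRel_R1_adj {ιA ιB : Type} {d : ℕ} {A : ιA → Fin d → Bool}
    {B : ιB → Fin d → Bool} {u v : V1 ιA ιB d} (h : R1 A B u v) :
    (SimpleGraph.fromRel (R1 A B)).Adj u v := by
  refine (SimpleGraph.fromRel_adj _ _ _).2 ⟨?_, Or.inl h⟩
  rintro rfl
  cases u <;> exact h

/-- For every `a ∈ A`: (i) if for every `b ∈ B` there is a coordinate `j` with
`a(j) = b(j) = 1`, then the eccentricity of the vertex `a` in `G` is at most `3`;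
(ii) if some `b ∈ B` is orthogonal to `a`, then the distance from `a` to the copy
`b' ∈ B'` is at least `5`, and hence the eccentricity of `a` is at least `5`. -/
theorem stmt_1 {ιA ιB : Type} [Fintype ιA] [Fintype ιB] {d : ℕ} (hd : 1 ≤ d)
    (A : ιA → Fin d → Bool) (B : ιB → Fin d → Bool) (i : ιA) :
    ((∀ j : ιB, ∃ k : Fin d, A i k = true ∧ B j k = true) →
      ∀ w : V1 ιA ιB d, (SimpleGraph.fromRel (R1 A B)).edist (V1.a i) w ≤ 3) ∧
    (∀ j : ιB, (∀ k : Fin d, ¬ (A i k = true ∧ B j k = true)) →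
      5 ≤ (SimpleGraph.fromRel (R1 A B)).edist (V1.a i) (V1.b' j) ∧
      5 ≤ ⨆ w : V1 ιA ιB d, (SimpleGraph.fromRel (R1 A B)).edist (V1.a i) w) := by
  have hx : (SimpleGraph.fromRel (R1 A B)).Adj (V1.a i) V1.x :=
    (fromRel_R1_adj (u := V1.x) (v := V1.a i) trivial).symm
  have hxy : (SimpleGraph.fromRel (R1 A B)).Adj V1.x V1.y := fromRel_R1_adj trivial
  refine ⟨fun h w => ?_, fun j hj => ?_⟩
  · suffices ∃ p : (SimpleGraph.fromRel (R1 A B)).Walk (V1.a i) w, p.length ≤ 3 by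
      obtain ⟨p, hp⟩ := this
      exact (SimpleGraph.edist_le p).trans (by exact_mod_cast hp)
    cases w with
    | a i' =>
      exact ⟨.cons hx (.cons (fromRel_R1_adj (u := V1.x) (v := V1.a i') trivial) .nil), by simp⟩
    | b j =>
      obtain ⟨k, hA, hB⟩ := h j
      exact ⟨.cons (fromRel_R1_adj (v := V1.c k) hA)
        (.cons (fromRel_R1_adj (u := V1.b j) (v := V1.c k) hB).symm .nil), by simp⟩
    | b' j =>
      obtain ⟨k, hA, hB⟩ := h j
      exact ⟨.cons (fromRel_R1_adj (v := V1.c k) hA)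
        (.cons (fromRel_R1_adj (u := V1.b j) (v := V1.c k) hB).symm
          (.cons (fromRel_R1_adj (u := V1.b j) (v := V1.b' j) rfl) .nil)), by simp⟩
    | c k =>
      exact ⟨.cons hx (.cons hxy
        (.cons (fromRel_R1_adj (u := V1.y) (v := V1.c k) trivial) .nil)), by simp⟩
    | x => exact ⟨.cons hx .nil, by simp⟩
    | y => exact ⟨.cons hx (.cons hxy .nil), by simp⟩
  · have hdist : 5 ≤ (SimpleGraph.fromRel (R1 A B)).edist (V1.a i) (V1.b' j) := by
      have hle := SimpleGraph.le_add_edist_of_adj (G := SimpleGraph.fromRel (R1 A B))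
        (f := distLowerBound A B j)
        (fun u v huv => ((SimpleGraph.fromRel_adj _ _ _).1 huv).2.elim
          (fun h => (distLowerBound_le_of_rel j h).1)
          (fun h => (distLowerBound_le_of_rel j h).2)) (V1.a i) (V1.b' j)
      have hi : distLowerBound A B j (V1.a i) = 5 := if_neg (not_exists.2 hj)
      have hj' : distLowerBound A B j (V1.b' j) = 0 := if_pos rfl
      simpa [hi, hj'] using hle
    exact ⟨hdist, hdist.trans
      (le_iSup (fun w => (SimpleGraph.fromRel (R1 A B)).edist (V1.a i) w) (V1.b' j))⟩
end

section
/- (i) If some a ∈ A satisfies a ∩ b ≠ ∅ for every b ∈ B, then rt(a,v) ≤ 4 for every vertex v ∈ A ∪ B_1 ∪ B_2 ∪ C_1 ∪ C_2 ∪ D_1 ∪ D_2. (ii) If no member of A intersects every member of B, then every vertex c of F has some vertex v with rt(c,v) ≥ 8. -/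
/-- `HasWalk E u v n`: there is a directed walk with `n` arcs from `u` to `v`. -/
def HasWalk {V : Type*} (E : V → V → Prop) : V → V → ℕ → Prop
  | u, v, 0 => u = v
  | u, v, n + 1 => ∃ w, E u w ∧ HasWalk E w v n

/-- Directed shortest-path distance: the number of arcs in a shortest directed
path from `u` to `v`, and `∞` if there is no such path. -/
noncomputable def ddist {V : Type*} (E : V → V → Prop) (u v : V) : ℕ∞ :=
  ⨅ (n : ℕ) (_ : HasWalk E u v n), (n : ℕ∞)

/-- Vertex set of the graph `F`: the part `A` is shared between the two copies
(indexed by `h : Bool`) of the gadget `H(A,B,U)`; each copy has parts `B`, `C`, `D`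
(`C`, `D` being copies of `U`) and the internal vertices of the directed `3`-paths.
An internal vertex `p h i u s k` lies in copy `h`, on the `3`-path joining the
vertex `a i` and the copy of `u` in `C` (if `s = false`) or in `D` (if `s = true`),
at position `k ∈ Fin 2` along the path. -/
inductive V4 (ιA ιB U : Type) where
  | a : ιA → V4 ιA ιB U
  | b : Bool → ιB → V4 ιA ιB U
  | c : Bool → U → V4 ιA ιB U
  | d : Bool → U → V4 ιA ιB U
  | p : Bool → ιA → U → Bool → Fin 2 → V4 ιA ιB U

/-- The arcs of `F`.  In each copy `h`, for `a ∈ A` and `u ∈ U`: if `u ∈ a` there are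
the arc `a → u_C`, a directed `3`-path `u_C → ⋯ → a`, the arc `u_D → a` and a
directed `3`-path `a → ⋯ → u_D`; if `u ∉ a` the roles of arcs and `3`-paths are
reversed.  For `b ∈ B` and `u ∈ b` there are the arcs `u_C → b` and `b → u_D`. -/
def E4 {ιA ιB U : Type} (A : ιA → Set U) (B : ιB → Set U) :
    V4 ιA ιB U → V4 ιA ιB U → Prop
  | .a i, .c _ u => u ∈ A i
  | .c _ u, .a i => u ∉ A i
  | .d _ u, .a i => u ∈ A i
  | .a i, .d _ u => u ∉ A i
  | .a i, .p _ i' u s k => i = i' ∧ (k : ℕ) = 0 ∧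
      ((s = false ∧ u ∉ A i) ∨ (s = true ∧ u ∈ A i))
  | .p _ i u s k, .a i' => i = i' ∧ (k : ℕ) = 1 ∧
      ((s = false ∧ u ∈ A i) ∨ (s = true ∧ u ∉ A i))
  | .c h u, .p h' i u' s k => h = h' ∧ u = u' ∧ s = false ∧ (k : ℕ) = 0 ∧ u ∈ A i
  | .p h i u s k, .c h' u' => h = h' ∧ u = u' ∧ s = false ∧ (k : ℕ) = 1 ∧ u ∉ A i
  | .d h u, .p h' i u' s k => h = h' ∧ u = u' ∧ s = true ∧ (k : ℕ) = 0 ∧ u ∉ A i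
  | .p h i u s k, .d h' u' => h = h' ∧ u = u' ∧ s = true ∧ (k : ℕ) = 1 ∧ u ∈ A i
  | .p h i u s k, .p h' i' u' s' k' =>
      h = h' ∧ i = i' ∧ u = u' ∧ s = s' ∧ (k : ℕ) = 0 ∧ (k' : ℕ) = 1
  | .c h u, .b h' j => h = h' ∧ u ∈ B j
  | .b h j, .d h' u => h = h' ∧ u ∈ B j
  | _, _ => False

/-- Roundtrip distance in the directed graph with arc relation `E`. -/
noncomputable def rt4 {V : Type*} (E : V → V → Prop) (u v : V) : ℕ∞ :=
  ddist E u v + ddist E v u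

section Distance

variable {V : Type*} {E : V → V → Prop} {u v : V}

lemma ddist_le_of_hasWalk {n : ℕ} (h : HasWalk E u v n) : ddist E u v ≤ n :=
  iInf₂_le n h

lemma le_ddist_of_forall_not_hasWalk {m : ℕ} (h : ∀ n < m, ¬ HasWalk E u v n) :
    (m : ℕ∞) ≤ ddist E u v :=
  le_iInf₂ fun n hn => by
    by_contra hlt
    exact h n (by exact_mod_cast not_le.mp hlt) hn

lemma rt4_le_of_hasWalk {k l m : ℕ} (h : HasWalk E u v k) (h' : HasWalk E v u l)
    (hm : k + l ≤ m) : rt4 E u v ≤ m :=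
  (add_le_add (ddist_le_of_hasWalk h) (ddist_le_of_hasWalk h')).trans (by exact_mod_cast hm)

lemma eight_le_rt4 (h : ∀ n < 4, ¬ HasWalk E u v n) (h' : ∀ n < 4, ¬ HasWalk E v u n) :
    8 ≤ rt4 E u v :=
  calc (8 : ℕ∞) = (4 : ℕ) + (4 : ℕ) := by norm_num
    _ ≤ rt4 E u v := add_le_add (le_ddist_of_forall_not_hasWalk h)
      (le_ddist_of_forall_not_hasWalk h')

end Distance

section Gadget

variable {ιA ιB U : Type} {A : ιA → Set U} {B : ιB → Set U}

lemma hasWalk_a_a {i i' : ιA} (h : ∃ u, u ∈ A i ∧ u ∉ A i') :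
    HasWalk (E4 A B) (.a i) (.a i') 2 :=
  let ⟨u, hu, hu'⟩ := h
  ⟨.c true u, hu, .a i', hu', rfl⟩

lemma not_hasWalk_a_b {i : ιA} {j : ιB} (hij : ¬ (A i ∩ B j).Nonempty) (h : Bool) :
    ∀ n < 4, ¬ HasWalk (E4 A B) (.a i) (.b h j) n := by
  have hd : ∀ u, u ∈ A i → u ∉ B j := fun u hu hu' => hij ⟨u, hu, hu'⟩
  intro n hn
  interval_cases n
  · simp [HasWalk]
  · rintro ⟨w, hw, rfl⟩
    simp [E4] at hw
  · rintro ⟨w, hw, x, hx, rfl⟩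
    rcases w with _ | _ | _ | _ | _ <;> simp only [E4] at hw hx
    grind
  · rintro ⟨w, hw, x, hx, y, hy, rfl⟩
    rcases w with _ | _ | _ | _ | _ <;> simp only [E4] at hw <;>
      rcases x with _ | _ | _ | _ | _ <;> simp only [E4] at hx hy
    grind

lemma not_hasWalk_b_a {i : ιA} {j : ιB} (hij : ¬ (A i ∩ B j).Nonempty) (h : Bool) :
    ∀ n < 4, ¬ HasWalk (E4 A B) (.b h j) (.a i) n := by
  have hd : ∀ u, u ∈ A i → u ∉ B j := fun u hu hu' => hij ⟨u, hu, hu'⟩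
  intro n hn
  interval_cases n
  · simp [HasWalk]
  · rintro ⟨w, hw, rfl⟩
    simp [E4] at hw
  · rintro ⟨w, hw, x, hx, rfl⟩
    rcases w with _ | _ | _ | _ | _ <;> simp only [E4] at hw hx
    grind
  · rintro ⟨w, hw, x, hx, y, hy, rfl⟩
    rcases w with _ | _ | _ | _ | _ <;> simp only [E4] at hw <;>
      rcases x with _ | _ | _ | _ | _ <;> simp only [E4] at hx hy
    grind

lemma not_hasWalk_b_b {h h' : Bool} (hne : h ≠ h') (j : ιB) :
    ∀ n < 4, ¬ HasWalk (E4 A B) (.b h j) (.b h' j) n := by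
  intro n hn
  interval_cases n
  · simp [HasWalk, hne]
  · rintro ⟨w, hw, rfl⟩
    simp [E4] at hw
  · rintro ⟨w, hw, x, hx, rfl⟩
    rcases w with _ | _ | _ | _ | _ <;> simp only [E4] at hw hx
  · rintro ⟨w, hw, x, hx, y, hy, rfl⟩
    rcases w with _ | _ | _ | _ | _ <;> simp only [E4] at hw <;>
      rcases x with _ | _ | _ | _ | _ <;> simp only [E4] at hx hy

lemma not_hasWalk_c_c {h h' : Bool} (hne : h ≠ h') (u : U) :
    ∀ n < 4, ¬ HasWalk (E4 A B) (.c h u) (.c h' u) n := by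
  intro n hn
  interval_cases n
  · simp [HasWalk, hne]
  · rintro ⟨w, hw, rfl⟩
    simp [E4] at hw
  · rintro ⟨w, hw, x, hx, rfl⟩
    rcases w with _ | _ | _ | _ | _ <;> simp only [E4] at hw hx <;> grind
  · rintro ⟨w, hw, x, hx, y, hy, rfl⟩
    rcases w with _ | _ | _ | _ | _ <;> simp only [E4] at hw <;>
      rcases x with _ | _ | _ | _ | _ <;> simp only [E4] at hx hy <;> grind

lemma not_hasWalk_d_d {h h' : Bool} (hne : h ≠ h') (u : U) :
    ∀ n < 4, ¬ HasWalk (E4 A B) (.d h u) (.d h' u) n := by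
  intro n hn
  interval_cases n
  · simp [HasWalk, hne]
  · rintro ⟨w, hw, rfl⟩
    simp [E4] at hw
  · rintro ⟨w, hw, x, hx, rfl⟩
    rcases w with _ | _ | _ | _ | _ <;> simp only [E4] at hw hx <;> grind
  · rintro ⟨w, hw, x, hx, y, hy, rfl⟩
    rcases w with _ | _ | _ | _ | _ <;> simp only [E4] at hw <;>
      rcases x with _ | _ | _ | _ | _ <;> simp only [E4] at hx hy <;> grind

lemma not_hasWalk_p_p {h h' : Bool} (hne : h ≠ h') (i : ιA) (u : U) (s : Bool) (k : Fin 2) :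
    ∀ n < 4, ¬ HasWalk (E4 A B) (.p h i u s k) (.p h' i u s k) n := by
  intro n hn
  interval_cases n
  · simp [HasWalk, hne]
  · rintro ⟨w, hw, rfl⟩
    simp [E4, hne] at hw
  · rintro ⟨w, hw, x, hx, rfl⟩
    rcases w with _ | _ | _ | _ | _ <;> simp only [E4] at hw hx <;> grind
  · rintro ⟨w, hw, x, hx, y, hy, rfl⟩
    rcases w with _ | _ | _ | _ | _ <;> simp only [E4] at hw <;>
      rcases x with _ | _ | _ | _ | _ <;> simp only [E4] at hx hy <;> grind

end Gadget

/-- (i) If some `a ∈ A` intersects every member of `B`, then `rt(a,v) ≤ 4` for every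
vertex `v ∈ A ∪ B₁ ∪ B₂ ∪ C₁ ∪ C₂ ∪ D₁ ∪ D₂`.  (ii) If no member of `A` intersects
every member of `B`, then every vertex `c` of `F` has some vertex `v` with
`rt(c,v) ≥ 8`. -/
theorem stmt_4 {ιA ιB U : Type} [Fintype ιA] [Fintype ιB] [Fintype U]
    (A : ιA → Set U) (B : ιB → Set U)
    (hA : ∀ i i' : ιA, i ≠ i' → ∃ u : U, u ∈ A i ∧ u ∉ A i') :
    (∀ i : ιA, (∀ j : ιB, (A i ∩ B j).Nonempty) →
      (∀ i' : ιA, rt4 (E4 A B) (V4.a i) (V4.a i') ≤ 4) ∧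
      (∀ (h : Bool) (j : ιB), rt4 (E4 A B) (V4.a i) (V4.b h j) ≤ 4) ∧
      (∀ (h : Bool) (u : U), rt4 (E4 A B) (V4.a i) (V4.c h u) ≤ 4) ∧
      (∀ (h : Bool) (u : U), rt4 (E4 A B) (V4.a i) (V4.d h u) ≤ 4)) ∧
    ((¬ ∃ i : ιA, ∀ j : ιB, (A i ∩ B j).Nonempty) →
      ∀ c : V4 ιA ιB U, ∃ v : V4 ιA ιB U, 8 ≤ rt4 (E4 A B) c v) := by
  refine ⟨fun i hi => ⟨fun i' => ?_, fun h j => ?_, fun h u => ?_, fun h u => ?_⟩, fun hno x => ?_⟩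
  · rcases eq_or_ne i i' with rfl | hne
    · exact rt4_le_of_hasWalk (k := 0) (l := 0) (m := 4) rfl rfl (by norm_num)
    · exact rt4_le_of_hasWalk (m := 4) (hasWalk_a_a (hA i i' hne)) (hasWalk_a_a (hA i' i hne.symm))
        le_rfl
  · obtain ⟨u, hu, hu'⟩ := hi j
    exact rt4_le_of_hasWalk (k := 2) (l := 2) (m := 4)
      ⟨.c h u, hu, .b h j, ⟨rfl, hu'⟩, rfl⟩ ⟨.d h u, ⟨rfl, hu'⟩, .a i, hu, rfl⟩ le_rfl
  · by_cases hu : u ∈ A i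
    · exact rt4_le_of_hasWalk (k := 1) (l := 3) (m := 4) ⟨.c h u, hu, rfl⟩
        ⟨.p h i u false 0, by simp [E4, hu], .p h i u false 1, by simp [E4], .a i,
          by simp [E4, hu], rfl⟩ le_rfl
    · exact rt4_le_of_hasWalk (k := 3) (l := 1) (m := 4)
        ⟨.p h i u false 0, by simp [E4, hu], .p h i u false 1, by simp [E4], .c h u,
          by simp [E4, hu], rfl⟩ ⟨.a i, hu, rfl⟩ le_rfl
  · by_cases hu : u ∈ A i
    · exact rt4_le_of_hasWalk (k := 3) (l := 1) (m := 4)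
        ⟨.p h i u true 0, by simp [E4, hu], .p h i u true 1, by simp [E4], .d h u,
          by simp [E4, hu], rfl⟩ ⟨.a i, hu, rfl⟩ le_rfl
    · exact rt4_le_of_hasWalk (k := 1) (l := 3) (m := 4) ⟨.d h u, hu, rfl⟩
        ⟨.p h i u true 0, by simp [E4, hu], .p h i u true 1, by simp [E4], .a i,
          by simp [E4, hu], rfl⟩ le_rfl
  · push Not at hno
    cases x with
    | a i =>
      obtain ⟨j, hj⟩ := hno i
      rw [← Set.not_nonempty_iff_eq_empty] at hj
      exact ⟨.b true j, eight_le_rt4 (not_hasWalk_a_b hj true) (not_hasWalk_b_a hj true)⟩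
    | b h j =>
      exact ⟨.b (!h) j, eight_le_rt4 (not_hasWalk_b_b (by simp) j) (not_hasWalk_b_b (by simp) j)⟩
    | c h u =>
      exact ⟨.c (!h) u, eight_le_rt4 (not_hasWalk_c_c (by simp) u) (not_hasWalk_c_c (by simp) u)⟩
    | d h u =>
      exact ⟨.d (!h) u, eight_le_rt4 (not_hasWalk_d_d (by simp) u) (not_hasWalk_d_d (by simp) u)⟩
    | p h i u s k =>
      exact ⟨.p (!h) i u s k, eight_le_rt4 (not_hasWalk_p_p (by simp) i u s k)
        (not_hasWalk_p_p (by simp) i u s k)⟩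
end

section
/- (i) If A_i satisfies A_i ∩ B_j ≠ ∅ for every j, then S(A_i) = M*. (ii) If A_i ∩ B_j = ∅ for some j, then S(A_i) ≥ M* + 2. (iii) If moreover n ≥ 9 and |U| ≥ 9, then S(v) > M* for every vertex v not in A; consequently the minimum of S(v) over all vertices v equals M* if and only if some A_i intersects every B_j. -/
/-- Vertex set of the graph `G'`: the disjoint union of the index sets of
`A = (A_1, …, A_n)` and `B = (B_1, …, B_n)`, the universe `U`, a second copy
`U_N` of `U`, three vertices `x`, `y`, `z`, and three sets
`X`, `Y`, `Z` of `n'` vertices each. -/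
inductive V5 (U : Type) (n n' : ℕ) where
  | a : Fin n → V5 U n n'
  | b : Fin n → V5 U n n'
  | u : U → V5 U n n'
  | uN : U → V5 U n n'
  | x : V5 U n n'
  | y : V5 U n n'
  | z : V5 U n n'
  | xs : Fin n' → V5 U n n'
  | ys : Fin n' → V5 U n n'
  | zs : Fin n' → V5 U n n'
  deriving DecidableEq, Fintype

/-- The edge relation of `G'` (one direction of each undirected edge):
`{A_i, u}` for `u ∈ A_i`; `{u, B_j}` for `u ∈ B_j`; `{A_i, u_N}` for `u ∉ A_i`;
`{A_i, x}`; `{x, x_k}`; `{B_j, y}`; `{y, y_k}`; `{u_N, z}`; and `{z, z_k}`. -/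
def R5 {U : Type} {n n' : ℕ} (A B : Fin n → Set U) :
    V5 U n n' → V5 U n n' → Prop
  | .a i, .u w => w ∈ A i
  | .u w, .b j => w ∈ B j
  | .a i, .uN w => w ∉ A i
  | .a _, .x => True
  | .x, .xs _ => True
  | .b _, .y => True
  | .y, .ys _ => True
  | .uN _, .z => True
  | .z, .zs _ => True
  | _, _ => False

/-- A potential that changes by at most one along each edge bounds distances from below. -/
theorem SimpleGraph.natCast_le_add_edist {V : Type*} {G : SimpleGraph V} (f : V → ℕ)
    (hf : ∀ p q, G.Adj p q → f p ≤ f q + 1) (v w : V) :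
    (f v : ℕ∞) ≤ f w + G.edist v w := by
  by_cases h : G.edist v w = ⊤
  · simp [h]
  · obtain ⟨p, hp⟩ := SimpleGraph.exists_walk_of_edist_ne_top h
    rw [← hp]
    have key : ∀ {v w : V} (p : G.Walk v w), f v ≤ f w + p.length := by
      intro v w p
      induction p with
      | nil => simp
      | cons hadj p ih =>
        have := hf _ _ hadj
        simp only [SimpleGraph.Walk.length_cons]
        omega
    exact_mod_cast key p

theorem SimpleGraph.Adj.edist_le_add_one {V : Type*} {G : SimpleGraph V} {v p q : V} {m : ℕ}
    (hpq : G.Adj p q) (hm : G.edist v p ≤ m) : G.edist v q ≤ (m + 1 : ℕ) := by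
  have htri := G.edist_triangle (u := v) (v := p) (w := q)
  rw [SimpleGraph.edist_eq_one_iff_adj.2 hpq] at htri
  push_cast
  exact htri.trans (by gcongr)

namespace V5

variable {U : Type} {n n' : ℕ}

/-- `V5 U n n'` as an iterated sum type. -/
def equivSum (U : Type) (n n' : ℕ) :
    V5 U n n' ≃ Fin n ⊕ Fin n ⊕ U ⊕ U ⊕ Unit ⊕ Unit ⊕ Unit ⊕ Fin n' ⊕ Fin n' ⊕ Fin n' where
  toFun
    | a i => .inl i
    | b j => .inr (.inl j)
    | u w => .inr (.inr (.inl w))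
    | uN w => .inr (.inr (.inr (.inl w)))
    | x => .inr (.inr (.inr (.inr (.inl ()))))
    | y => .inr (.inr (.inr (.inr (.inr (.inl ())))))
    | z => .inr (.inr (.inr (.inr (.inr (.inr (.inl ()))))))
    | xs k => .inr (.inr (.inr (.inr (.inr (.inr (.inr (.inl k)))))))
    | ys k => .inr (.inr (.inr (.inr (.inr (.inr (.inr (.inr (.inl k))))))))
    | zs k => .inr (.inr (.inr (.inr (.inr (.inr (.inr (.inr (.inr k))))))))
  invFun
    | .inl i => a i
    | .inr (.inl j) => b j
    | .inr (.inr (.inl w)) => u w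
    | .inr (.inr (.inr (.inl w))) => uN w
    | .inr (.inr (.inr (.inr (.inl ())))) => x
    | .inr (.inr (.inr (.inr (.inr (.inl ()))))) => y
    | .inr (.inr (.inr (.inr (.inr (.inr (.inl ())))))) => z
    | .inr (.inr (.inr (.inr (.inr (.inr (.inr (.inl k))))))) => xs k
    | .inr (.inr (.inr (.inr (.inr (.inr (.inr (.inr (.inl k)))))))) => ys k
    | .inr (.inr (.inr (.inr (.inr (.inr (.inr (.inr (.inr k)))))))) => zs k
  left_inv v := by cases v <;> rfl
  right_inv v := by
    rcases v with _ | _ | _ | _ | _ | _ | _ | _ | _ | _ <;> rfl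

theorem sum_eq [Fintype U] {M : Type*} [AddCommMonoid M] (g : V5 U n n' → M) :
    ∑ w, g w = ∑ i, g (a i) + (∑ j, g (b j) + (∑ w, g (u w) + (∑ w, g (uN w) +
      (g x + (g y + (g z + (∑ k, g (xs k) + (∑ k, g (ys k) + ∑ k, g (zs k))))))))) := by
  rw [← (equivSum U n n').symm.sum_comp]
  simp [Fintype.sum_sum_type, equivSum]

/-- The distance to the set `X` of pendant vertices, as far as it depends on vertex types only. -/
def distX : V5 U n n' → ℕ
  | xs _ => 0
  | x => 1
  | a _ => 2
  | u _ => 3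
  | uN _ => 3
  | b _ => 4
  | z => 4
  | y => 5
  | zs _ => 5
  | ys _ => 6

/-- The distance to the set `Y` of pendant vertices, as far as it depends on vertex types only. -/
def distY : V5 U n n' → ℕ
  | ys _ => 0
  | y => 1
  | b _ => 2
  | u _ => 3
  | a _ => 4
  | x => 5
  | uN _ => 5
  | xs _ => 6
  | z => 6
  | zs _ => 7

/-- The distance to the set `Z` of pendant vertices, as far as it depends on vertex types only. -/
def distZ : V5 U n n' → ℕ
  | zs _ => 0
  | z => 1
  | uN _ => 2
  | a _ => 3
  | u _ => 4
  | x => 4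
  | b _ => 5
  | xs _ => 5
  | y => 6
  | ys _ => 7

open scoped Classical in
/-- The distance from `a i` when every `B j` meets `A i`; a lower bound for it in general. -/
noncomputable def distA (A B : Fin n → Set U) (i : Fin n) : V5 U n n' → ℕ
  | a k => if k = i then 0 else 2
  | b j => if (A i ∩ B j).Nonempty then 2 else 4
  | u w => if w ∈ A i then 1 else 3
  | uN w => if w ∈ A i then 3 else 1
  | x => 1
  | y => 3
  | z => 2
  | xs _ => 2
  | ys _ => 4
  | zs _ => 3

variable {A B : Fin n → Set U}

theorem adj_lipschitz {f : V5 U n n' → ℕ}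
    (hf : ∀ p q, R5 A B p q → f p ≤ f q + 1 ∧ f q ≤ f p + 1) (p q : V5 U n n')
    (h : (SimpleGraph.fromRel (R5 A B)).Adj p q) : f p ≤ f q + 1 := by
  rcases ((SimpleGraph.fromRel_adj _ _ _).1 h).2 with h | h
  · exact (hf _ _ h).1
  · exact (hf _ _ h).2

theorem distX_le_edist (v : V5 U n n') (k : Fin n') :
    (distX v : ℕ∞) ≤ (SimpleGraph.fromRel (R5 A B)).edist v (xs k) := by
  simpa [distX] using SimpleGraph.natCast_le_add_edist distX
    (adj_lipschitz (A := A) (B := B) fun p q h => by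
      cases p <;> cases q <;> simp_all [R5, distX]) v (xs k)

theorem distY_le_edist (v : V5 U n n') (k : Fin n') :
    (distY v : ℕ∞) ≤ (SimpleGraph.fromRel (R5 A B)).edist v (ys k) := by
  simpa [distY] using SimpleGraph.natCast_le_add_edist distY
    (adj_lipschitz (A := A) (B := B) fun p q h => by
      cases p <;> cases q <;> simp_all [R5, distY]) v (ys k)

theorem distZ_le_edist (v : V5 U n n') (k : Fin n') :
    (distZ v : ℕ∞) ≤ (SimpleGraph.fromRel (R5 A B)).edist v (zs k) := by
  simpa [distZ] using SimpleGraph.natCast_le_add_edist distZ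
    (adj_lipschitz (A := A) (B := B) fun p q h => by
      cases p <;> cases q <;> simp_all [R5, distZ]) v (zs k)

theorem distA_le_edist (i : Fin n) (w : V5 U n n') :
    (distA A B i w : ℕ∞) ≤ (SimpleGraph.fromRel (R5 A B)).edist (a i) w := by
  rw [SimpleGraph.edist_comm]
  have hlip : ∀ p q : V5 U n n', R5 A B p q →
      distA A B i p ≤ distA A B i q + 1 ∧ distA A B i q ≤ distA A B i p + 1 := by
    intro p q h
    cases p <;> cases q <;> simp only [R5, distA] at h ⊢
    case u.b w j =>
      by_cases hw : w ∈ A i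
      · have : (A i ∩ B j).Nonempty := ⟨w, hw, h⟩
        simp [hw, this]
      · split_ifs <;> simp
    all_goals try split_ifs
    all_goals simp_all
  simpa [distA] using SimpleGraph.natCast_le_add_edist (distA A B i) (adj_lipschitz hlip) w (a i)

theorem edist_le_distA (hprop : ∀ i, A i ≠ Set.univ)
    (hin : ∀ u : U, ∃ i, u ∈ A i) (hout : ∀ u : U, ∃ i, u ∉ A i) (i : Fin n)
    (hi : ∀ j, (A i ∩ B j).Nonempty) (w : V5 U n n') :
    (SimpleGraph.fromRel (R5 A B)).edist (a i) w ≤ distA A B i w := by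
  set G := SimpleGraph.fromRel (R5 A B (n' := n')) with hG
  have adj : ∀ {p q : V5 U n n'}, p ≠ q → R5 A B p q → G.Adj p q := fun hne h =>
    (SimpleGraph.fromRel_adj _ _ _).2 ⟨hne, .inl h⟩
  have h0 : G.edist (a i) (a i) ≤ (0 : ℕ) := by simp
  have hx : G.edist (a i) x ≤ (1 : ℕ) :=
    (adj (p := a i) (q := x) (by simp) trivial).edist_le_add_one h0
  have ha (k) : G.edist (a i) (a k) ≤ (2 : ℕ) :=
    (adj (p := a k) (q := x) (by simp) trivial).symm.edist_le_add_one hx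
  have hu {w} {k} {m : ℕ} (hk : w ∈ A k) (hm : G.edist (a i) (a k) ≤ m) :
      G.edist (a i) (u w) ≤ (m + 1 : ℕ) :=
    (adj (p := a k) (q := u w) (by simp) hk).edist_le_add_one hm
  have huN {w} {k} {m : ℕ} (hk : w ∉ A k) (hm : G.edist (a i) (a k) ≤ m) :
      G.edist (a i) (uN w) ≤ (m + 1 : ℕ) :=
    (adj (p := a k) (q := uN w) (by simp) hk).edist_le_add_one hm
  have hb (j) : G.edist (a i) (b j) ≤ (2 : ℕ) := by
    obtain ⟨w, hw, hwj⟩ := hi j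
    exact (adj (p := u w) (q := b j) (by simp) hwj).edist_le_add_one (hu hw h0)
  have hy : G.edist (a i) y ≤ (3 : ℕ) :=
    (adj (p := b i) (q := y) (by simp) trivial).edist_le_add_one (hb i)
  have hz : G.edist (a i) z ≤ (2 : ℕ) := by
    obtain ⟨w, hw⟩ := (Set.ne_univ_iff_exists_notMem _).1 (hprop i)
    exact (adj (p := uN w) (q := z) (by simp) trivial).edist_le_add_one (huN hw h0)
  cases w with
  | a k =>
    simp only [distA]
    split_ifs with h
    · subst h; exact h0
    · exact ha k
  | b j => simpa only [distA, if_pos (hi j)] using hb j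
  | u w =>
    simp only [distA]
    split_ifs with h
    · exact hu h h0
    · obtain ⟨k, hk⟩ := hin w
      exact hu hk (ha k)
  | uN w =>
    simp only [distA]
    split_ifs with h
    · obtain ⟨k, hk⟩ := hout w
      exact huN hk (ha k)
    · exact huN h h0
  | x => exact hx
  | y => exact hy
  | z => exact hz
  | xs k => exact (adj (p := x) (q := xs k) (by simp) trivial).edist_le_add_one hx
  | ys k => exact (adj (p := y) (q := ys k) (by simp) trivial).edist_le_add_one hy
  | zs k => exact (adj (p := z) (q := zs k) (by simp) trivial).edist_le_add_one hz

theorem sum_distA [Fintype U] (i : Fin n) :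
    ∑ w : V5 U n n', distA A B i w =
      9 * n' + 2 * n + 4 * Fintype.card U + 4 + ∑ j, distA A B i (b j : V5 U n n') := by
  have ha : ∑ k, distA A B i (a k : V5 U n n') + 2 = 2 * n := by
    rw [← Finset.add_sum_erase _ _ (Finset.mem_univ i),
      Finset.sum_congr rfl (g := fun _ => 2) fun k hk => by simp [distA, Finset.ne_of_mem_erase hk]]
    have := i.pos
    simp [distA]
    omega
  have hu : ∑ w, distA A B i (u w : V5 U n n') + ∑ w, distA A B i (uN w : V5 U n n') =
      4 * Fintype.card U := by
    rw [← Finset.sum_add_distrib, Finset.sum_congr rfl (g := fun _ => 4) fun w _ => by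
      simp only [distA]; split_ifs <;> rfl]
    simp [mul_comm]
  rw [sum_eq]
  have hc : (distA A B i (x : V5 U n n') + (distA A B i (y : V5 U n n') +
      (distA A B i (z : V5 U n n') + (∑ k, distA A B i (xs k : V5 U n n') +
      (∑ k, distA A B i (ys k : V5 U n n') + ∑ k, distA A B i (zs k : V5 U n n')))))) =
      9 * n' + 6 := by
    simp [distA]; ring
  rw [hc]
  omega

theorem ten_mul_le_sum_edist [Fintype U] (v : V5 U n n') (hv : ∀ i, v ≠ a i) :
    ((10 * n' : ℕ) : ℕ∞) ≤ ∑ w, (SimpleGraph.fromRel (R5 A B)).edist v w := by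
  have hten : 10 ≤ distX v + (distY v + distZ v) := by
    cases v <;> simp_all [distX, distY, distZ]
  calc ((10 * n' : ℕ) : ℕ∞)
      ≤ ((n' * distX v + (n' * distY v + n' * distZ v) : ℕ) : ℕ∞) := by
        exact_mod_cast (by nlinarith)
    _ = ∑ _k : Fin n', (distX v : ℕ∞) + (∑ _k : Fin n', (distY v : ℕ∞) +
          ∑ _k : Fin n', (distZ v : ℕ∞)) := by simp
    _ ≤ _ := add_le_add (Finset.sum_le_sum fun k _ => distX_le_edist (A := A) (B := B) v k)
        (add_le_add (Finset.sum_le_sum fun k _ => distY_le_edist (A := A) (B := B) v k)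
          (Finset.sum_le_sum fun k _ => distZ_le_edist (A := A) (B := B) v k))
    _ ≤ _ := by
        rw [sum_eq]
        iterate 7 refine le_add_of_le_right ?_
        exact le_rfl

end V5

/-- With `n' = n·|U|` and `M* = 9n' + 4n + 4|U| + 4`:
(i) if `A_i` intersects every `B_j`, then `S(A_i) = M*`;
(ii) if `A_i` is disjoint from some `B_j`, then `S(A_i) ≥ M* + 2`;
(iii) if moreover `n ≥ 9` and `|U| ≥ 9`, then `S(v) > M*` for every vertex `v`
not in `A`, and consequently the minimum of `S(v)` over all vertices equals `M*`
iff some `A_i` intersects every `B_j`.  Here `S(v) = ∑_w d(v,w)`. -/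
theorem stmt_5 {U : Type} [Fintype U] [DecidableEq U] [Nonempty U]
    {n : ℕ} (hn : 1 ≤ n) (A B : Fin n → Set U)
    (hprop : ∀ i, A i ≠ Set.univ)
    (hin : ∀ u : U, ∃ i, u ∈ A i)
    (hout : ∀ u : U, ∃ i, u ∉ A i) :
    (∀ i : Fin n, (∀ j : Fin n, (A i ∩ B j).Nonempty) →
      (∑ w : V5 U n (n * Fintype.card U),
          (SimpleGraph.fromRel (R5 A B)).edist (V5.a i) w) =
        ((9 * (n * Fintype.card U) + 4 * n + 4 * Fintype.card U + 4 : ℕ) : ℕ∞)) ∧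
    (∀ i : Fin n, (∃ j : Fin n, A i ∩ B j = ∅) →
      ((9 * (n * Fintype.card U) + 4 * n + 4 * Fintype.card U + 4 + 2 : ℕ) : ℕ∞) ≤
        ∑ w : V5 U n (n * Fintype.card U),
          (SimpleGraph.fromRel (R5 A B)).edist (V5.a i) w) ∧
    (9 ≤ n → 9 ≤ Fintype.card U →
      (∀ v : V5 U n (n * Fintype.card U), (∀ i : Fin n, v ≠ V5.a i) →
        ((9 * (n * Fintype.card U) + 4 * n + 4 * Fintype.card U + 4 : ℕ) : ℕ∞) <
          ∑ w : V5 U n (n * Fintype.card U),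
            (SimpleGraph.fromRel (R5 A B)).edist v w) ∧
      ((⨅ v : V5 U n (n * Fintype.card U),
          ∑ w : V5 U n (n * Fintype.card U),
            (SimpleGraph.fromRel (R5 A B)).edist v w) =
          ((9 * (n * Fintype.card U) + 4 * n + 4 * Fintype.card U + 4 : ℕ) : ℕ∞) ↔
        ∃ i : Fin n, ∀ j : Fin n, (A i ∩ B j).Nonempty)) := by
  have heq : ∀ i : Fin n, (∀ j : Fin n, (A i ∩ B j).Nonempty) →
      (∑ w : V5 U n (n * Fintype.card U),
          (SimpleGraph.fromRel (R5 A B)).edist (V5.a i) w) =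
        ((9 * (n * Fintype.card U) + 4 * n + 4 * Fintype.card U + 4 : ℕ) : ℕ∞) := by
    intro i hi
    rw [Finset.sum_congr rfl fun w _ =>
      le_antisymm (V5.edist_le_distA hprop hin hout i hi w) (V5.distA_le_edist i w),
      ← Nat.cast_sum, V5.sum_distA]
    congr 1
    simp only [V5.distA, hi, if_true, Finset.sum_const, Finset.card_univ, Fintype.card_fin,
      smul_eq_mul]
    ring
  have hge : ∀ i : Fin n, (∃ j : Fin n, A i ∩ B j = ∅) →
      ((9 * (n * Fintype.card U) + 4 * n + 4 * Fintype.card U + 4 + 2 : ℕ) : ℕ∞) ≤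
        ∑ w : V5 U n (n * Fintype.card U),
          (SimpleGraph.fromRel (R5 A B)).edist (V5.a i) w := by
    rintro i ⟨j, hj⟩
    refine le_trans ?_ (Finset.sum_le_sum fun w _ => V5.distA_le_edist i w)
    rw [← Nat.cast_sum, V5.sum_distA, Nat.cast_le]
    have hlt : 2 * n + 2 ≤
        ∑ j, V5.distA A B i (V5.b j : V5 U n (n * Fintype.card U)) := by
      rw [← Finset.add_sum_erase _ _ (Finset.mem_univ j)]
      have hsum := Finset.card_nsmul_le_sum (Finset.univ.erase j)
        (fun j => V5.distA A B i (V5.b j : V5 U n (n * Fintype.card U))) 2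
        fun k _ => by simp only [V5.distA]; split_ifs <;> simp
      have hj4 : V5.distA A B i (V5.b j : V5 U n (n * Fintype.card U)) = 4 := by
        simp [V5.distA, hj]
      simp only [Finset.card_erase_of_mem (Finset.mem_univ j), Finset.card_univ,
        Fintype.card_fin, smul_eq_mul] at hsum
      omega
    omega
  refine ⟨heq, hge, fun hn9 hU9 => ?_⟩
  have hgt : ∀ v : V5 U n (n * Fintype.card U), (∀ i : Fin n, v ≠ V5.a i) →
      ((9 * (n * Fintype.card U) + 4 * n + 4 * Fintype.card U + 4 : ℕ) : ℕ∞) <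
        ∑ w : V5 U n (n * Fintype.card U),
          (SimpleGraph.fromRel (R5 A B)).edist v w := by
    intro v hv
    refine lt_of_lt_of_le ?_ (V5.ten_mul_le_sum_edist v hv)
    rw [Nat.cast_lt]
    nlinarith
  have hlt_of_disjoint : ∀ i : Fin n, (∃ j : Fin n, A i ∩ B j = ∅) →
      ((9 * (n * Fintype.card U) + 4 * n + 4 * Fintype.card U + 4 : ℕ) : ℕ∞) <
        ∑ w : V5 U n (n * Fintype.card U),
          (SimpleGraph.fromRel (R5 A B)).edist (V5.a i) w := fun i hi =>
    lt_of_lt_of_le (by rw [Nat.cast_lt]; omega) (hge i hi)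
  refine ⟨hgt, fun h => ?_, fun ⟨i, hi⟩ => le_antisymm ((iInf_le _ _).trans_eq (heq i hi)) ?_⟩
  · have : Nonempty (V5 U n (n * Fintype.card U)) := ⟨V5.x⟩
    obtain ⟨v, hv⟩ := exists_eq_ciInf_of_finite
      (f := fun v : V5 U n (n * Fintype.card U) =>
        ∑ w, (SimpleGraph.fromRel (R5 A B)).edist v w)
    rw [h] at hv
    by_contra! hno
    by_cases hva : ∃ i, v = V5.a i
    · obtain ⟨i, rfl⟩ := hva
      exact (hlt_of_disjoint i (hno i)).ne' hv
    · push Not at hva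
      exact (hgt v hva).ne' hv
  · refine le_iInf fun v => ?_
    by_cases hva : ∃ i, v = V5.a i
    · obtain ⟨k, rfl⟩ := hva
      by_cases hk : ∀ j, (A k ∩ B j).Nonempty
      · exact (heq k hk).ge
      · simp only [not_forall, Set.not_nonempty_iff_eq_empty] at hk
        exact (hlt_of_disjoint k hk).le
    · push Not at hva
      exact (hgt v hva).le
end

section
/- For every vertex j of G: j is reachable from every vertex i < j if and only if every vertex i < j has an out-arc to some vertex k with k ≤ j. -/
/-- In a DAG on `{1, …, n}` presented in topological order (all arcs go from a
smaller to a larger index), a vertex `j` is reachable from every vertex `i < j`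
iff every vertex `i < j` has an out-arc to some vertex `k ≤ j`. -/
theorem stmt_7 {n : ℕ} (E : Fin n → Fin n → Prop)
    (hE : ∀ v w : Fin n, E v w → v < w) (j : Fin n) :
    (∀ i : Fin n, i < j → Relation.ReflTransGen E i j) ↔
      (∀ i : Fin n, i < j → ∃ k : Fin n, E i k ∧ k ≤ j) := by
  have hle : ∀ {v w : Fin n}, Relation.ReflTransGen E v w → v ≤ w := by
    intro v w h
    induction h with
    | refl => exact le_rfl
    | tail _ hbc ih => exact ih.trans (hE _ _ hbc).le
  constructor
  · intro h i hi
    rcases (h i hi).cases_head with rfl | ⟨k, hik, hkj⟩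
    · exact absurd hi (lt_irrefl _)
    · exact ⟨k, hik, hle hkj⟩
  · intro h i
    induction i using WellFoundedGT.induction with
    | ind i ih =>
      intro hi
      obtain ⟨k, hik, hkj⟩ := h i hi
      rcases hkj.eq_or_lt with rfl | hlt
      · exact .single hik
      · exact .head hik (ih k (hE _ _ hik) hlt)
end

section
/- Let G be a directed graph on {1,…,n} with all arcs from a smaller to a larger index, and suppose its min-diameter D (the maximum over pairs of distinct vertices v, w of min{d(v→w), d(w→v)}) is attained by a pair u* < v*, i.e. d(u*→v*) = D. Then for every vertex w with u* ≤ w ≤ v*, the quantity M = max{ max_{v ≤ w} d(v→w), max_{w ≤ v} d(w→v) } satisfies M ≤ D ≤ 2M. -/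
theorem HasWalk.trans {V : Type*} {E : V → V → Prop} {v w : V} {m : ℕ} (hvw : HasWalk E v w m) :
    ∀ {k : ℕ} {u : V}, HasWalk E u v k → HasWalk E u w (k + m)
  | 0, _, h => by
    obtain rfl : _ = v := h
    simpa using hvw
  | k + 1, _, ⟨x, hx, h⟩ => by
    rw [Nat.add_right_comm]
    exact ⟨x, hx, hvw.trans h⟩

theorem HasWalk.le_of_forall_lt {V : Type*} [Preorder V] {E : V → V → Prop}
    (hE : ∀ v w, E v w → v < w) : ∀ {k : ℕ} {u v : V}, HasWalk E u v k → u ≤ v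
  | 0, _, _, h => le_of_eq h
  | _ + 1, _, _, ⟨_, hx, h⟩ => (hE _ _ hx).le.trans (HasWalk.le_of_forall_lt hE h)

theorem HasWalk.ddist_le {V : Type*} {E : V → V → Prop} {u v : V} {k : ℕ}
    (h : HasWalk E u v k) : ddist E u v ≤ k :=
  iInf₂_le k h

theorem exists_hasWalk_of_ddist_ne_top {V : Type*} {E : V → V → Prop} {u v : V}
    (h : ddist E u v ≠ ⊤) : ∃ k : ℕ, HasWalk E u v k ∧ ddist E u v = k := by
  obtain ⟨k, hk⟩ := ciInf_mem (fun k : ℕ => ⨅ _ : HasWalk E u v k, (k : ℕ∞))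
  change _ = ddist E u v at hk
  by_cases hw : HasWalk E u v k
  · exact ⟨k, hw, by simpa [hw] using hk.symm⟩
  · exact absurd (by simpa [hw] using hk.symm) h

theorem ddist_self {V : Type*} (E : V → V → Prop) (v : V) : ddist E v v = 0 :=
  le_antisymm (HasWalk.ddist_le (k := 0) rfl) zero_le

theorem ddist_triangle {V : Type*} (E : V → V → Prop) (u v w : V) :
    ddist E u w ≤ ddist E u v + ddist E v w := by
  by_cases huv : ddist E u v = ⊤
  · simp [huv]
  by_cases hvw : ddist E v w = ⊤
  · simp [hvw]
  obtain ⟨k, hk, hk'⟩ := exists_hasWalk_of_ddist_ne_top huv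
  obtain ⟨m, hm, hm'⟩ := exists_hasWalk_of_ddist_ne_top hvw
  rw [hk', hm']
  exact_mod_cast (hm.trans hk).ddist_le

theorem ddist_eq_top_of_lt {V : Type*} [Preorder V] {E : V → V → Prop}
    (hE : ∀ v w, E v w → v < w) {u v : V} (h : v < u) : ddist E u v = ⊤ := by
  by_contra hne
  obtain ⟨k, hk, -⟩ := exists_hasWalk_of_ddist_ne_top hne
  exact (hk.le_of_forall_lt hE).not_gt h

/-- Let `G` be a DAG on `{1, …, n}` in topological order whose min-diameter `D` is
attained by a pair `u* < v*` (so `d(u*→v*) = D`).  Then for every vertex `w` with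
`u* ≤ w ≤ v*`, the quantity
`M = max{ max_{v ≤ w} d(v→w), max_{w ≤ v} d(w→v) }` satisfies `M ≤ D ≤ 2M`. -/
theorem stmt_10 {n : ℕ} (E : Fin n → Fin n → Prop)
    (hE : ∀ v w : Fin n, E v w → v < w) (D : ℕ∞) (ustar vstar : Fin n)
    (hlt : ustar < vstar) (hatt : ddist E ustar vstar = D)
    (hdiam : ∀ v w : Fin n, v ≠ w → min (ddist E v w) (ddist E w v) ≤ D)
    (w : Fin n) (h1 : ustar ≤ w) (h2 : w ≤ vstar) :
    max (⨆ v : Fin n, ⨆ _ : v ≤ w, ddist E v w)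
        (⨆ v : Fin n, ⨆ _ : w ≤ v, ddist E w v) ≤ D ∧
    D ≤ 2 * max (⨆ v : Fin n, ⨆ _ : v ≤ w, ddist E v w)
        (⨆ v : Fin n, ⨆ _ : w ≤ v, ddist E w v) := by
  have key : ∀ a b : Fin n, a ≤ b → ddist E a b ≤ D := by
    intro a b hab
    rcases hab.eq_or_lt with rfl | hab
    · simp [ddist_self]
    · simpa [ddist_eq_top_of_lt hE hab] using hdiam a b hab.ne
  refine ⟨max_le (iSup₂_le fun v hv => key v w hv) (iSup₂_le fun v hv => key w v hv), ?_⟩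
  rw [← hatt, two_mul]
  refine (ddist_triangle E ustar w vstar).trans (add_le_add ?_ ?_)
  · exact (le_iSup₂ (f := fun v (_ : v ≤ w) => ddist E v w) ustar h1).trans (le_max_left _ _)
  · exact (le_iSup₂ (f := fun v (_ : w ≤ v) => ddist E w v) vstar h2).trans (le_max_right _ _)
end

section
/- (i) If every a ∈ A and every b ∈ B share a coordinate c with a(c) = b(c) = 1, then the min-diameter of G' is at most t+1. (ii) If some a ∈ A and b ∈ B are orthogonal (there is no coordinate c with a(c) = b(c) = 1), then min{d(a→b), d(b→a)} ≥ 2t, so the min-diameter of G' is at least 2t. -/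
/-- `WalkCost w u v c`: there is a directed walk from `u` to `v` of total
arc-weight `c` (arcs that are absent have weight `∞`). -/
inductive WalkCost {V : Type*} (w : V → V → ℕ∞) : V → V → ℕ∞ → Prop where
  | nil (u : V) : WalkCost w u u 0
  | cons {u x v : V} {c : ℕ∞} : WalkCost w x v c → WalkCost w u v (w u x + c)

/-- Weighted directed shortest-path distance: the minimum total weight of a
directed path from `u` to `v`, and `∞` if there is no such path. -/
noncomputable def wdist {V : Type*} (w : V → V → ℕ∞) (u v : V) : ℕ∞ :=
  sInf {c : ℕ∞ | WalkCost w u v c}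

/-- Vertex set of the weighted directed graph `G'`: the disjoint union of the index
sets of the Boolean-vector families `A` and `B`, the coordinate set `C = Fin d`,
and three extra vertices `x`, `y`, `z`. -/
inductive V15 (ιA ιB : Type) (d : ℕ) where
  | a : ιA → V15 ιA ιB d
  | b : ιB → V15 ιA ιB d
  | c : Fin d → V15 ιA ιB d
  | x : V15 ιA ιB d
  | y : V15 ιA ιB d
  | z : V15 ιA ιB d

/-- The weighted arcs of `G'` (weight `∞` means no arc): `a → c` of weight `s` when
`a(c) = 1`; `c → b` of weight `s` when `b(c) = 1`; `a → x` of weight `1` and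
`x → a` of weight `t = 2s`; `c → x` of weight `1`; `b → y` of weight `t` and
`y → b` of weight `1`; `y → c` of weight `1`; `c → z` and `z → c` of weight `s`;
and `y → x` of weight `1`. -/
def W15 {ιA ιB : Type} {d : ℕ} (A : ιA → Fin d → Bool) (B : ιB → Fin d → Bool)
    (s : ℕ) : V15 ιA ιB d → V15 ιA ιB d → ℕ∞
  | .a i, .c j => if A i j then (s : ℕ∞) else ⊤
  | .c j, .b i => if B i j then (s : ℕ∞) else ⊤
  | .a _, .x => 1
  | .x, .a _ => (2 * s : ℕ)
  | .c _, .x => 1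
  | .b _, .y => (2 * s : ℕ)
  | .y, .b _ => 1
  | .y, .c _ => 1
  | .c _, .z => (s : ℕ)
  | .z, .c _ => (s : ℕ)
  | .y, .x => 1
  | _, _ => ⊤

theorem wdist_le_arc {V : Type*} (w : V → V → ℕ∞) (u v : V) : wdist w u v ≤ w u v :=
  sInf_le (by simpa using WalkCost.cons (w := w) (u := u) (WalkCost.nil v))

theorem wdist_le_two_arcs {V : Type*} (w : V → V → ℕ∞) (u p v : V) :
    wdist w u v ≤ w u p + w p v :=
  sInf_le (by
    simpa using WalkCost.cons (w := w) (u := u) (WalkCost.cons (u := p) (WalkCost.nil v)))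

/-- A function that drops along each arc by at most the weight of the arc drops along each walk
by at most the cost of the walk. -/
theorem WalkCost.potential_le {V : Type*} {w : V → V → ℕ∞} {f : V → ℕ∞}
    (hf : ∀ u v, f u ≤ w u v + f v) {u v : V} {c : ℕ∞} (h : WalkCost w u v c) :
    f u ≤ c + f v := by
  induction h with
  | nil u => simp
  | cons _ ih => exact (hf _ _).trans (by rw [add_assoc]; gcongr)

theorem potential_le_wdist {V : Type*} {w : V → V → ℕ∞} {f : V → ℕ∞}
    (hf : ∀ u v, f u ≤ w u v + f v) {u v : V} (hv : f v = 0) : f u ≤ wdist w u v :=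
  le_sInf fun _ h => by simpa [hv] using h.potential_le hf

open Classical in
/-- A lower bound for the distance to `b j` when `a i` and `b j` are orthogonal. -/
noncomputable def potentialToB {ιA ιB : Type} {d : ℕ} (B : ιB → Fin d → Bool) (s : ℕ)
    (i : ιA) (j : ιB) : V15 ιA ιB d → ℕ
  | .a i' => if i' = i then 4 * s else 2 * s
  | .b j' => if j' = j then 0 else 2 * s
  | .c k => if B j k then s else 3 * s
  | .x => 4 * s
  | .y => 0
  | .z => 2 * s

/-- A lower bound for the distance to any vertex of the form `a i`. -/
def potentialToA {ιA ιB : Type} {d : ℕ} (s : ℕ) : V15 ιA ιB d → ℕ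
  | .a _ => 0
  | .b _ => 4 * s
  | .c _ => 2 * s
  | .x => 2 * s
  | .y => 2 * s
  | .z => 2 * s

theorem potentialToB_le {ιA ιB : Type} {d : ℕ} {A : ιA → Fin d → Bool} {B : ιB → Fin d → Bool}
    (s : ℕ) {i : ιA} {j : ιB} (h : ∀ c : Fin d, ¬ (A i c = true ∧ B j c = true))
    (u v : V15 ιA ιB d) :
    (potentialToB B s i j u : ℕ∞) ≤ W15 A B s u v + (potentialToB B s i j v : ℕ∞) := by
  cases u <;> cases v <;> simp only [W15, potentialToB, top_add, le_top] <;> (try split_ifs) <;>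
    first
      | simp only [top_add, le_top]
      | (norm_cast <;> omega)
      | simp_all

theorem potentialToA_le {ιA ιB : Type} {d : ℕ} (A : ιA → Fin d → Bool) (B : ιB → Fin d → Bool)
    (s : ℕ) (u v : V15 ιA ιB d) :
    (potentialToA s u : ℕ∞) ≤ W15 A B s u v + (potentialToA s v : ℕ∞) := by
  cases u <;> cases v <;> simp only [W15, potentialToA, top_add, le_top] <;> (try split_ifs) <;>
    first
      | simp only [top_add, le_top]
      | (norm_cast <;> omega)

theorem le_min_wdist_of_orthogonal {ιA ιB : Type} {d : ℕ} {A : ιA → Fin d → Bool}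
    {B : ιB → Fin d → Bool} (s : ℕ) {i : ιA} {j : ιB}
    (h : ∀ c : Fin d, ¬ (A i c = true ∧ B j c = true)) :
    ((2 * (2 * s) : ℕ) : ℕ∞) ≤
      min (wdist (W15 A B s) (V15.a i) (V15.b j)) (wdist (W15 A B s) (V15.b j) (V15.a i)) := by
  have h4 : 2 * (2 * s) = 4 * s := by omega
  rw [h4]
  refine le_min ?_ ?_
  · simpa [potentialToB] using
      potential_le_wdist (potentialToB_le s h) (u := .a i) (v := .b j) (by simp [potentialToB])
  · simpa [potentialToA] using
      potential_le_wdist (potentialToA_le A B s) (u := .b j) (v := .a i) (by simp [potentialToA])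

theorem min_wdist_le_of_forall_common {ιA ιB : Type} [Nonempty ιA] [Nonempty ιB] {d s : ℕ}
    (hs : 1 ≤ s) {A : ιA → Fin d → Bool} {B : ιB → Fin d → Bool}
    (h : ∀ (i : ιA) (j : ιB), ∃ c : Fin d, A i c = true ∧ B j c = true)
    (v w : V15 ιA ιB d) (hvw : v ≠ w) :
    min (wdist (W15 A B s) v w) (wdist (W15 A B s) w v) ≤ ((2 * s : ℕ) : ℕ∞) + 1 := by
  obtain ⟨i₀⟩ := ‹Nonempty ιA›
  obtain ⟨j₀⟩ := ‹Nonempty ιB›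
  obtain ⟨k₀, -⟩ := h i₀ j₀
  have key : ∀ u v : V15 ιA ιB d,
      (W15 A B s u v ≤ ((2 * s : ℕ) : ℕ∞) + 1 ∨
        ∃ p, W15 A B s u p + W15 A B s p v ≤ ((2 * s : ℕ) : ℕ∞) + 1) →
      wdist (W15 A B s) u v ≤ ((2 * s : ℕ) : ℕ∞) + 1 := by
    rintro u v (h₁ | ⟨p, h₁⟩)
    · exact (wdist_le_arc _ _ _).trans h₁
    · exact (wdist_le_two_arcs _ _ p _).trans h₁
  have hab : ∀ i j, wdist (W15 A B s) (.a i) (.b j) ≤ ((2 * s : ℕ) : ℕ∞) + 1 := fun i j => by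
    obtain ⟨k, hA, hB⟩ := h i j
    refine key _ _ (.inr ⟨.c k, ?_⟩)
    simp only [W15, hA, hB, if_true]
    norm_cast
    omega
  have haz : ∀ i, wdist (W15 A B s) (.a i) .z ≤ ((2 * s : ℕ) : ℕ∞) + 1 := fun i => by
    obtain ⟨k, hA, -⟩ := h i j₀
    refine key _ _ (.inr ⟨.c k, ?_⟩)
    simp only [W15, hA, if_true]
    norm_cast
    omega
  have hzb : ∀ j, wdist (W15 A B s) .z (.b j) ≤ ((2 * s : ℕ) : ℕ∞) + 1 := fun j => by
    obtain ⟨k, -, hB⟩ := h i₀ j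
    refine key _ _ (.inr ⟨.c k, ?_⟩)
    simp only [W15, hB, if_true]
    norm_cast
    omega
  rw [min_le_iff]
  cases v <;> cases w <;>
    first
      | exact absurd rfl hvw
      | exact .inl (hab _ _)
      | exact .inr (hab _ _)
      | exact .inl (haz _)
      | exact .inr (haz _)
      | exact .inl (hzb _)
      | exact .inr (hzb _)
      | (refine .inl (key _ _ (.inl ?_)); simp only [W15]; norm_cast <;> omega)
      | (refine .inr (key _ _ (.inl ?_)); simp only [W15]; norm_cast <;> omega)
      | (refine .inl (key _ _ (.inr ⟨.x, ?_⟩)); simp only [W15]; norm_cast <;> omega)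
      | (refine .inr (key _ _ (.inr ⟨.x, ?_⟩)); simp only [W15]; norm_cast <;> omega)
      | (refine .inl (key _ _ (.inr ⟨.y, ?_⟩)); simp only [W15]; norm_cast <;> omega)
      | (refine .inr (key _ _ (.inr ⟨.y, ?_⟩)); simp only [W15]; norm_cast <;> omega)
      | (refine .inl (key _ _ (.inr ⟨.z, ?_⟩)); simp only [W15]; norm_cast <;> omega)
      | (refine .inl (key _ _ (.inr ⟨.c k₀, ?_⟩)); simp only [W15]; norm_cast <;> omega)
      | (refine .inr (key _ _ (.inr ⟨.c k₀, ?_⟩)); simp only [W15]; norm_cast <;> omega)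

/-- With `t = 2s`: (i) if every `a ∈ A` and `b ∈ B` share a coordinate `c` with
`a(c) = b(c) = 1`, then the min-diameter of `G'` is at most `t + 1`; (ii) if some
`a ∈ A` and `b ∈ B` are orthogonal, then `min{d(a→b), d(b→a)} ≥ 2t`, so the
min-diameter of `G'` is at least `2t`. -/
theorem stmt_15 {ιA ιB : Type} [Fintype ιA] [Fintype ιB]
    [Nonempty ιA] [Nonempty ιB] {d : ℕ} {s : ℕ} (hs : 1 ≤ s)
    (A : ιA → Fin d → Bool) (B : ιB → Fin d → Bool) :
    ((∀ (i : ιA) (j : ιB), ∃ c : Fin d, A i c = true ∧ B j c = true) →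
      ∀ v w : V15 ιA ιB d, v ≠ w →
        min (wdist (W15 A B s) v w) (wdist (W15 A B s) w v) ≤ ((2 * s : ℕ) : ℕ∞) + 1) ∧
    (∀ (i : ιA) (j : ιB), (∀ c : Fin d, ¬ (A i c = true ∧ B j c = true)) →
      ((2 * (2 * s) : ℕ) : ℕ∞) ≤
          min (wdist (W15 A B s) (V15.a i) (V15.b j))
            (wdist (W15 A B s) (V15.b j) (V15.a i)) ∧
      ((2 * (2 * s) : ℕ) : ℕ∞) ≤
        ⨆ v : V15 ιA ιB d, ⨆ w : V15 ιA ιB d, ⨆ _ : v ≠ w,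
          min (wdist (W15 A B s) v w) (wdist (W15 A B s) w v)) := by
  refine ⟨min_wdist_le_of_forall_common hs, fun i j h => ⟨le_min_wdist_of_orthogonal s h, ?_⟩⟩
  exact (le_min_wdist_of_orthogonal s h).trans
    (le_iSup_of_le (V15.a i) (le_iSup_of_le (V15.b j) (le_iSup_of_le (by simp) le_rfl)))
end
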